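/- Let $X$ be a second countable locally compact Hausdorff space, and let $A$, $B$, $C$ be $C_0(X)$-algebras with $C_0(X)$-linear *-homomorphisms $\phi : A \to B$ and $\psi : B \to C$. If for every $x \in X$ the induced sequence of fibres $0 \to A(x) \xrightarrow{\phi_x} B(x) \xrightarrow{\psi_x} C(x) \to 0$ is exact, then $0 \to A \xrightarrow{\phi} B \xrightarrow{\psi} C \to 0$ is exact. -/

import Mathlib

open scoped ZeroAtInfty

section Helpers

open Filter Topology

/-- The truncation trick: a selfadjoint element may be replaced by one whose norm is controlled by
the norm of the image. -/
theorem aux_trunc {A B : Type*} [NonUnitalCStarAlgebra A] [NonUnitalCStarAlgebra B]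
    (ψ : A →⋆ₙₐ[ℂ] B) (a : A) (ha : IsSelfAdjoint a) :
    ∃ a' : A, ψ a' = ψ a ∧ ‖a'‖ ≤ ‖ψ a‖ := by
  have hψa : IsSelfAdjoint (ψ a) := ha.map ψ
  set r := ‖ψ a‖ with hr
  have hr0 : 0 ≤ r := norm_nonneg _
  set f : ℝ → ℝ := fun t => max (-r) (min r t) with hf
  have hfc : Continuous f := by fun_prop
  have hf0 : f 0 = 0 := by simp [hf, hr0]
  have hψc : Continuous ψ := AddMonoidHomClass.continuous_of_bound ψ 1
    (fun a => by simpa using NonUnitalStarAlgHom.norm_apply_le ψ a)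
  refine ⟨cfcₙ f a, ?_, ?_⟩
  · rw [NonUnitalStarAlgHom.map_cfcₙ ψ f a hfc.continuousOn hf0 hψc ha hψa]
    conv_rhs => rw [← cfcₙ_id ℝ (ψ a) hψa]
    apply cfcₙ_congr
    intro t ht
    have h1 : ‖t‖ ≤ r := by
      have := norm_apply_le_norm_cfcₙ (id : ℝ → ℝ) (ψ a) ht
      rwa [cfcₙ_id ℝ (ψ a) hψa] at this
    rw [Real.norm_eq_abs, abs_le] at h1
    simp [hf, h1.1, h1.2]
  · apply norm_cfcₙ_le
    intro t _
    rw [Real.norm_eq_abs, abs_le]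
    refine ⟨le_max_left _ _, max_le (by linarith) (min_le_left _ _)⟩

/-- The range of a *-homomorphism of C*-algebras is closed. -/
theorem aux_closed_range {A B : Type*} [NonUnitalCStarAlgebra A] [NonUnitalCStarAlgebra B]
    (ψ : A →⋆ₙₐ[ℂ] B) : closure (Set.range ψ) ⊆ Set.range ψ := by
  have hbd : ∀ a, ‖ψ a‖ ≤ ‖a‖ := fun a => NonUnitalStarAlgHom.norm_apply_le ψ a
  let F : NormedAddGroupHom A B :=
    { toFun := ψ, map_add' := map_add ψ, bound' := ⟨1, fun a => by simpa using hbd a⟩ }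
  have hF : F.SurjectiveOnWith F.range 2 := by
    rintro _ ⟨a, rfl⟩
    change ∃ g, ψ g = ψ a ∧ ‖g‖ ≤ 2 * ‖ψ a‖
    obtain ⟨u, hu, hu'⟩ := aux_trunc ψ (realPart a : A) (realPart a).2
    obtain ⟨v, hv, hv'⟩ := aux_trunc ψ (imaginaryPart a : A) (imaginaryPart a).2
    refine ⟨u + Complex.I • v, ?_, ?_⟩
    · rw [map_add, map_smul, hu, hv, ← map_smul, ← map_add, realPart_add_I_smul_imaginaryPart]
    · have h1 : ψ (realPart a : A) = (realPart (ψ a) : B) := by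
        simp [realPart_apply_coe, map_star, ← Complex.coe_smul]
      have h2 : ψ (imaginaryPart a : A) = (imaginaryPart (ψ a) : B) := by
        simp [imaginaryPart_apply_coe, map_star, ← Complex.coe_smul]
      have h3 : ‖(realPart (ψ a) : B)‖ ≤ ‖ψ a‖ := realPart.norm_le (ψ a)
      have h4 : ‖(imaginaryPart (ψ a) : B)‖ ≤ ‖ψ a‖ := imaginaryPart.norm_le (ψ a)
      rw [h1] at hu'
      rw [h2] at hv'
      calc ‖u + Complex.I • v‖ ≤ ‖u‖ + ‖Complex.I • v‖ := norm_add_le _ _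
        _ = ‖u‖ + ‖v‖ := by rw [norm_smul, Complex.norm_I, one_mul]
        _ ≤ _ := by linarith
  have h := controlled_closure_of_complete (by norm_num) one_pos hF
  intro c hc
  obtain ⟨g, hg, -⟩ := h c hc
  exact ⟨g, hg⟩

/-- A property closed under addition, scalars and uniform approximation passes to the closure of
the span. -/
theorem aux_tendsto {X B : Type*} [NonUnitalCStarAlgebra B] (l : Filter X)
    (fib : X → Type*) [∀ x, NonUnitalCStarAlgebra (fib x)] (ev : ∀ x, B →⋆ₙₐ[ℂ] fib x)
    (T : Set B) (hT : ∀ b ∈ T, Tendsto (fun y => ‖ev y b‖) l (𝓝 0)) (b : B)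
    (hb : b ∈ closure (↑(Submodule.span ℂ T) : Set B)) :
    Tendsto (fun y => ‖ev y b‖) l (𝓝 0) := by
  have hspan : ∀ b ∈ Submodule.span ℂ T, Tendsto (fun y => ‖ev y b‖) l (𝓝 0) := by
    intro b hb
    induction hb using Submodule.span_induction with
    | mem b hb => exact hT b hb
    | zero => simpa using tendsto_const_nhds
    | add a b _ _ ha hb =>
      refine squeeze_zero (fun _ => norm_nonneg _) (fun y => ?_) (by simpa using ha.add hb)
      rw [map_add]
      exact norm_add_le _ _
    | smul c a _ ha =>
      simpa [norm_smul] using ha.const_mul ‖c‖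
  rw [Metric.tendsto_nhds]
  intro ε hε
  obtain ⟨b', hb', hbb'⟩ := Metric.mem_closure_iff.1 hb (ε / 2) (half_pos hε)
  filter_upwards [(Metric.tendsto_nhds.1 (hspan b' hb')) (ε / 2) (half_pos hε)] with y hy
  rw [dist_zero_right, norm_norm] at hy ⊢
  have h1 : ‖ev y (b - b')‖ ≤ ‖b - b'‖ := NonUnitalStarAlgHom.norm_apply_le _ _
  rw [dist_eq_norm] at hbb'
  have h2 : ev y b = ev y (b - b') + ev y b' := by rw [← map_add, sub_add_cancel]
  calc ‖ev y b‖ ≤ ‖ev y (b - b')‖ + ‖ev y b'‖ := h2 ▸ norm_add_le _ _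
    _ < ε := by linarith

/-- An element that is fibrewise in a `C₀(X)`-invariant additive subgroup is in its closure. -/
theorem aux_local {X : Type*} [TopologicalSpace X] [LocallyCompactSpace X] [T2Space X]
    [SecondCountableTopology X] {B : Type*} [NonUnitalCStarAlgebra B]
    (m : C₀(X, ℂ) → B → B)
    (hadd : ∀ f g a, m (f + g) a = m f a + m g a)
    (hadd' : ∀ f a b, m f (a + b) = m f a + m f b)
    (hmul : ∀ f g a, m (f * g) a = m f (m g a))
    (hsmul : ∀ (c : ℂ) f a, m (c • f) a = c • m f a)
    (hcentral : ∀ f a b, m f (a * b) = (m f a) * b ∧ m f (a * b) = a * (m f b))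
    (hnorm : ∀ f a, ‖m f a‖ ≤ ‖f‖ * ‖a‖)
    (hnondeg : closure (↑(Submodule.span ℂ {y : B | ∃ f a, y = m f a}) : Set B) = Set.univ)
    (fib : X → Type*) [∀ x, NonUnitalCStarAlgebra (fib x)] (ev : ∀ x, B →⋆ₙₐ[ℂ] fib x)
    (hker : ∀ x (a : B), ev x a = 0 ↔
      a ∈ closure (↑(Submodule.span ℂ {y : B | ∃ f b, f x = 0 ∧ y = m f b}) : Set B))
    (hev : ∀ b : B, ‖b‖ = ⨆ x, ‖ev x b‖)
    (S : AddSubgroup B) (hS : ∀ f, ∀ s ∈ S, m f s ∈ S) (b : B)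
    (hb : ∀ x, ∃ s ∈ S, ev x (b - s) = 0) : b ∈ closure (S : Set B) := by
  have hle : ∀ y (a : B), ‖ev y a‖ ≤ ‖a‖ := fun y a => NonUnitalStarAlgHom.norm_apply_le _ a
  have hevc : ∀ y, Continuous (ev y) := fun y =>
    AddMonoidHomClass.continuous_of_bound (ev y) 1 (fun a => by simpa using hle y a)
  -- the action of functions on fibres, first on elements of the form `m g a`
  have hker' : ∀ y f a, f y = 0 → ev y (m f a) = 0 := fun y f a hf =>
    (hker y _).2 (subset_closure (Submodule.subset_span ⟨f, a, hf, rfl⟩))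
  have hevm0 : ∀ y f g a, ev y (m f (m g a)) = f y • ev y (m g a) := by
    intro y f g a
    have h1 := hker' y (f * g + (-(f y)) • g) a (by simp)
    rw [hadd, hsmul, hmul, map_add, map_smul, neg_smul, add_neg_eq_zero] at h1
    exact h1
  let L : C₀(X, ℂ) → B →+ B := fun f => AddMonoidHom.mk' (m f) (hadd' f)
  have hLc : ∀ f, Continuous (m f) := fun f =>
    AddMonoidHomClass.continuous_of_bound (L f) ‖f‖ (hnorm f)
  -- compatibility of `m f` with scalars, proved on the fibres
  have hevm : ∀ y f a, ev y (m f a) = f y • ev y a := by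
    intro y f a
    have hclosed : IsClosed {a : B | ev y (m f a) = f y • ev y a} :=
      isClosed_eq ((hevc y).comp (hLc f)) ((hevc y).const_smul _)
    have hsub : (↑(Submodule.span ℂ {y : B | ∃ f a, y = m f a}) : Set B) ⊆
        {a : B | ev y (m f a) = f y • ev y a} := by
      intro a ha
      induction ha using Submodule.span_induction with
      | mem a ha =>
        obtain ⟨g, a, rfl⟩ := ha
        exact hevm0 y f g a
      | zero =>
        have : m f 0 = 0 := (L f).map_zero
        simp [this]
      | add a b _ _ ha hb =>
        simp only [Set.mem_ofPred_eq] at ha hb ⊢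
        rw [hadd', map_add, map_add, ha, hb, smul_add]
      | smul c a _ ha =>
        have key : m f (c • a) = c • m f a := by
          have h1 : ∀ b, b * (m f (c • a) - c • m f a) = 0 := by
            intro b
            rw [mul_sub, mul_smul_comm, ← (hcentral f b _).2, ← (hcentral f b _).2,
              (hcentral f b _).1, (hcentral f b _).1, mul_smul_comm, sub_self]
          exact sub_eq_zero.1 (CStarRing.star_mul_self_eq_zero_iff _ |>.1 (h1 _))
        simp only [Set.mem_ofPred_eq] at ha ⊢
        rw [key, map_smul, map_smul, ha, smul_comm]
    have := closure_minimal hsub hclosed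
    rw [hnondeg] at this
    exact this (Set.mem_univ a)
  -- behaviour at infinity and near a zero
  have hinf : Tendsto (fun y => ‖ev y b‖) (cocompact X) (𝓝 0) := by
    apply aux_tendsto _ fib ev {y : B | ∃ f a, y = m f a} _ b (hnondeg ▸ Set.mem_univ b)
    rintro _ ⟨f, a, rfl⟩
    refine squeeze_zero (g := fun y => ‖f y‖ * ‖a‖) (fun _ => norm_nonneg _) (fun y => ?_) ?_
    · rw [hevm, norm_smul]
      gcongr
      exact hle y a
    · simpa using ((zero_at_infty f).norm.mul_const ‖a‖)
  have hzero : ∀ x (d : B), ev x d = 0 → Tendsto (fun y => ‖ev y d‖) (𝓝 x) (𝓝 0) := by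
    intro x d hd
    apply aux_tendsto _ fib ev _ _ d ((hker x d).1 hd)
    rintro _ ⟨f, a, hf, rfl⟩
    refine squeeze_zero (g := fun y => ‖f y‖ * ‖a‖) (fun _ => norm_nonneg _) (fun y => ?_) ?_
    · rw [hevm, norm_smul]
      gcongr
      exact hle y a
    · have := ((map_continuous f).tendsto x).norm.mul_const ‖a‖
      simpa [hf] using this
  rw [Metric.mem_closure_iff]
  intro ε' hε'
  obtain ⟨ε, hε, hεε'⟩ := exists_between hε'
  choose s hsS hs using hb
  -- the exceptional compact set
  obtain ⟨K, hK, hKb⟩ : ∃ K : Set X, IsCompact K ∧ ∀ y ∉ K, ‖ev y b‖ ≤ ε := by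
    have h := (Metric.tendsto_nhds.1 hinf) ε hε
    obtain ⟨K, hK, hKs⟩ := mem_cocompact.1 h
    refine ⟨K, hK, fun y hy => ?_⟩
    have := hKs hy
    simp only [Set.mem_ofPred_eq, dist_zero_right, norm_norm] at this
    exact this.le
  have hU : ∀ x, ∃ U : Set X, IsOpen U ∧ x ∈ U ∧ (∀ y ∈ U, ‖ev y (b - s x)‖ ≤ ε) ∧
      ∃ Q, IsCompact Q ∧ U ⊆ Q := by
    intro x
    have h := (Metric.tendsto_nhds.1 (hzero x _ (hs x))) ε hε
    obtain ⟨Q, hQ, hQx⟩ := exists_compact_mem_nhds x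
    obtain ⟨U, hUs, hUo, hxU⟩ := mem_nhds_iff.1 (inter_mem h hQx)
    refine ⟨U, hUo, hxU, fun y hy => ?_, Q, hQ, fun y hy => (hUs hy).2⟩
    have := (hUs hy).1
    simp only [Set.mem_ofPred_eq, dist_zero_right, norm_norm] at this
    exact this.le
  choose U hUo hxU hUb Q hQ hUQ using hU
  obtain ⟨t, ht⟩ := hK.elim_finite_subcover U hUo
    (fun x _ => Set.mem_iUnion.2 ⟨x, hxU x⟩)
  have ht' : K ⊆ ⋃ i : t, U i := by
    intro x hx
    have := ht hx
    simp only [Set.mem_iUnion] at this ⊢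
    obtain ⟨i, hi, hxi⟩ := this
    exact ⟨⟨i, hi⟩, hxi⟩
  obtain ⟨ρ, hρ⟩ := PartitionOfUnity.exists_isSubordinate_of_locallyFinite hK.isClosed
    (fun i : t => U i) (fun i => hUo i) (locallyFinite_of_finite _) ht'
  have hsupp : ∀ i : t, HasCompactSupport (fun y => (ρ i y : ℂ)) := by
    intro i
    refine HasCompactSupport.intro (hQ i) (fun y hy => ?_)
    have : y ∉ tsupport (ρ i) := fun h => hy (hUQ i (hρ i h))
    simp [image_eq_zero_of_notMem_tsupport this]
  let h : t → C₀(X, ℂ) := fun i =>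
    { toFun := fun y => (ρ i y : ℂ)
      continuous_toFun := by fun_prop
      zero_at_infty' := (hsupp i).is_zero_at_infty }
  have hh : ∀ i y, h i y = (ρ i y : ℂ) := fun _ _ => rfl
  refine ⟨∑ i, m (h i) (s i), S.sum_mem (fun i _ => hS _ _ (hsS i)), ?_⟩
  rw [dist_eq_norm]
  refine lt_of_le_of_lt ?_ hεε'
  rw [hev]
  refine Real.iSup_le (fun y => ?_) hε.le
  have hsum : ∑ᶠ i, ρ i y = ∑ i, ρ i y := finsum_eq_sum_of_fintype _
  have hle1 : ∑ i, ρ i y ≤ 1 := hsum ▸ ρ.sum_le_one y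
  have e1 : ev y (b - ∑ i, m (h i) (s i)) =
      ((1 - ∑ i, ρ i y : ℝ) : ℂ) • ev y b + ∑ i, (ρ i y : ℂ) • ev y (b - s i) := by
    simp only [map_sub, map_sum, hevm, hh, smul_sub, Finset.sum_sub_distrib, ← Finset.sum_smul]
    push_cast
    rw [sub_smul, one_smul]
    abel
  rw [e1]
  have b1 : ‖((1 - ∑ i, ρ i y : ℝ) : ℂ) • ev y b‖ ≤ (1 - ∑ i, ρ i y) * ε := by
    rw [norm_smul, Complex.norm_real, Real.norm_of_nonneg (by linarith)]
    by_cases hy : y ∈ K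
    · have : ∑ i, ρ i y = 1 := hsum ▸ ρ.sum_eq_one hy
      rw [this, sub_self, zero_mul, zero_mul]
    · exact mul_le_mul_of_nonneg_left (hKb y hy) (by linarith)
  have b2 : ∀ i, ‖(ρ i y : ℂ) • ev y (b - s i)‖ ≤ ρ i y * ε := by
    intro i
    rw [norm_smul, Complex.norm_real, Real.norm_of_nonneg (ρ.nonneg i y)]
    by_cases hy : y ∈ U i
    · exact mul_le_mul_of_nonneg_left (hUb i y hy) (ρ.nonneg i y)
    · have : y ∉ tsupport (ρ i) := fun h => hy (hρ i h)
      simp [image_eq_zero_of_notMem_tsupport this]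
  calc _ ≤ (1 - ∑ i, ρ i y) * ε + ∑ i, ρ i y * ε :=
        (norm_add_le _ _).trans (add_le_add b1 ((norm_sum_le _ _).trans
          (Finset.sum_le_sum fun i _ => b2 i)))
    _ = ε := by rw [← Finset.sum_mul]; ring

end Helpers

/-- Let `X` be a second countable locally compact Hausdorff
space and let `A`, `B`, `C` be `C₀(X)`-algebras (C*-algebras with a
nondegenerate central action of `C₀(X, ℂ)`, here given by actions `mA`, `mB`,
`mC`), with `C₀(X)`-linear *-homomorphisms `φ : A → B` and `ψ : B → C`.  The
fibre `A(x)` is the quotient of `A` by the closed ideal generated by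
`{f • a : f x = 0}`, presented here by surjective evaluation maps `evA x` with
that kernel.  If for every `x ∈ X` the induced sequence of fibres
`0 → A(x) → B(x) → C(x) → 0` is exact, then `0 → A → B → C → 0` is exact. -/
theorem stmt3
    {X : Type*} [TopologicalSpace X] [LocallyCompactSpace X] [T2Space X]
    [SecondCountableTopology X]
    {A B C : Type*} [NonUnitalCStarAlgebra A] [NonUnitalCStarAlgebra B]
    [NonUnitalCStarAlgebra C]
    -- the `C₀(X)`-module structures
    (mA : C₀(X, ℂ) → A → A) (mB : C₀(X, ℂ) → B → B) (mC : C₀(X, ℂ) → C → C)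
    (hAadd : ∀ f g a, mA (f + g) a = mA f a + mA g a)
    (hAadd' : ∀ f a b, mA f (a + b) = mA f a + mA f b)
    (hAmul : ∀ f g a, mA (f * g) a = mA f (mA g a))
    (hAsmul : ∀ (c : ℂ) f a, mA (c • f) a = c • mA f a)
    (hAcentral : ∀ f a b, mA f (a * b) = (mA f a) * b ∧ mA f (a * b) = a * (mA f b))
    (hAstar : ∀ f a, star (mA f a) = mA (star f) (star a))
    (hAnorm : ∀ f a, ‖mA f a‖ ≤ ‖f‖ * ‖a‖)
    (hAnondeg : closure (↑(Submodule.span ℂ {y : A | ∃ f a, y = mA f a}) : Set A) = Set.univ)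
    (hBadd : ∀ f g a, mB (f + g) a = mB f a + mB g a)
    (hBadd' : ∀ f a b, mB f (a + b) = mB f a + mB f b)
    (hBmul : ∀ f g a, mB (f * g) a = mB f (mB g a))
    (hBsmul : ∀ (c : ℂ) f a, mB (c • f) a = c • mB f a)
    (hBcentral : ∀ f a b, mB f (a * b) = (mB f a) * b ∧ mB f (a * b) = a * (mB f b))
    (hBstar : ∀ f a, star (mB f a) = mB (star f) (star a))
    (hBnorm : ∀ f a, ‖mB f a‖ ≤ ‖f‖ * ‖a‖)
    (hBnondeg : closure (↑(Submodule.span ℂ {y : B | ∃ f a, y = mB f a}) : Set B) = Set.univ)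
    (hCadd : ∀ f g a, mC (f + g) a = mC f a + mC g a)
    (hCadd' : ∀ f a b, mC f (a + b) = mC f a + mC f b)
    (hCmul : ∀ f g a, mC (f * g) a = mC f (mC g a))
    (hCsmul : ∀ (c : ℂ) f a, mC (c • f) a = c • mC f a)
    (hCcentral : ∀ f a b, mC f (a * b) = (mC f a) * b ∧ mC f (a * b) = a * (mC f b))
    (hCstar : ∀ f a, star (mC f a) = mC (star f) (star a))
    (hCnorm : ∀ f a, ‖mC f a‖ ≤ ‖f‖ * ‖a‖)
    (hCnondeg : closure (↑(Submodule.span ℂ {y : C | ∃ f a, y = mC f a}) : Set C) = Set.univ)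
    -- the fibres and the evaluation maps
    (Afib Bfib Cfib : X → Type*)
    [∀ x, NonUnitalCStarAlgebra (Afib x)] [∀ x, NonUnitalCStarAlgebra (Bfib x)]
    [∀ x, NonUnitalCStarAlgebra (Cfib x)]
    (evA : ∀ x, A →⋆ₙₐ[ℂ] Afib x) (evB : ∀ x, B →⋆ₙₐ[ℂ] Bfib x)
    (evC : ∀ x, C →⋆ₙₐ[ℂ] Cfib x)
    (hevAsurj : ∀ x, Function.Surjective (evA x))
    (hevBsurj : ∀ x, Function.Surjective (evB x))
    (hevCsurj : ∀ x, Function.Surjective (evC x))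
    (hkerA : ∀ x (a : A), evA x a = 0 ↔
      a ∈ closure (↑(Submodule.span ℂ {y : A | ∃ f b, f x = 0 ∧ y = mA f b}) : Set A))
    (hkerB : ∀ x (a : B), evB x a = 0 ↔
      a ∈ closure (↑(Submodule.span ℂ {y : B | ∃ f b, f x = 0 ∧ y = mB f b}) : Set B))
    (hkerC : ∀ x (a : C), evC x a = 0 ↔
      a ∈ closure (↑(Submodule.span ℂ {y : C | ∃ f b, f x = 0 ∧ y = mC f b}) : Set C))
    -- the norm of a section is the sup over the fibres
    (hnormA : ∀ a : A, ‖a‖ = ⨆ x, ‖evA x a‖)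
    (hnormB : ∀ b : B, ‖b‖ = ⨆ x, ‖evB x b‖)
    (hnormC : ∀ c : C, ‖c‖ = ⨆ x, ‖evC x c‖)
    -- the `C₀(X)`-linear *-homomorphisms and the induced maps on fibres
    (φ : A →⋆ₙₐ[ℂ] B) (ψ : B →⋆ₙₐ[ℂ] C)
    (hφlin : ∀ f a, φ (mA f a) = mB f (φ a))
    (hψlin : ∀ f b, ψ (mB f b) = mC f (ψ b))
    (φx : ∀ x, Afib x →⋆ₙₐ[ℂ] Bfib x) (ψx : ∀ x, Bfib x →⋆ₙₐ[ℂ] Cfib x)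
    (hφx : ∀ x a, φx x (evA x a) = evB x (φ a))
    (hψx : ∀ x b, ψx x (evB x b) = evC x (ψ b))
    -- fibrewise exactness
    (hφxinj : ∀ x, Function.Injective (φx x))
    (hψxsurj : ∀ x, Function.Surjective (ψx x))
    (hexfib : ∀ x, Set.range (φx x) = {b | ψx x b = 0}) :
    Function.Injective φ ∧ Function.Surjective ψ ∧ Set.range φ = {b : B | ψ b = 0} := by
  have zA : ∀ a : A, (∀ x, evA x a = 0) → a = 0 := fun a h => by
    rw [← norm_eq_zero, hnormA]; simp [h]
  have zC : ∀ a : C, (∀ x, evC x a = 0) → a = 0 := fun a h => by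
    rw [← norm_eq_zero, hnormC]; simp [h]
  have hcomp : ∀ x a, ψx x (φx x a) = 0 := by
    intro x a
    have h : φx x a ∈ Set.range (φx x) := ⟨a, rfl⟩
    rw [hexfib] at h
    exact h
  refine ⟨?_, ?_, ?_⟩
  · rw [injective_iff_map_eq_zero]
    intro a ha
    refine zA a fun x => hφxinj x ?_
    rw [hφx, ha, map_zero, map_zero]
  · intro c
    apply aux_closed_range ψ
    refine aux_local mC hCadd hCadd' hCmul hCsmul hCcentral hCnorm hCnondeg Cfib evC hkerC hnormC
      (AddMonoidHom.range (ψ : B →+ C)) ?_ c ?_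
    · rintro f _ ⟨b, rfl⟩
      exact ⟨mB f b, hψlin f b⟩
    · intro x
      obtain ⟨d, hd⟩ := hψxsurj x (evC x c)
      obtain ⟨b, rfl⟩ := hevBsurj x d
      refine ⟨ψ b, ⟨b, rfl⟩, ?_⟩
      rw [map_sub, ← hψx, hd, sub_self]
  · apply Set.Subset.antisymm
    · rintro _ ⟨a, rfl⟩
      refine zC _ fun x => ?_
      rw [← hψx, ← hφx, hcomp]
    · intro b hb
      apply aux_closed_range φ
      refine aux_local mB hBadd hBadd' hBmul hBsmul hBcentral hBnorm hBnondeg Bfib evB hkerB hnormB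
        (AddMonoidHom.range (φ : A →+ B)) ?_ b ?_
      · rintro f _ ⟨a, rfl⟩
        exact ⟨mA f a, hφlin f a⟩
      · intro x
        have h1 : evB x b ∈ {b | ψx x b = 0} := by
          change ψx x (evB x b) = 0
          rw [hψx, show ψ b = 0 from hb, map_zero]
        rw [← hexfib] at h1
        obtain ⟨d, hd⟩ := h1
        obtain ⟨a, rfl⟩ := hevAsurj x d
        refine ⟨φ a, ⟨a, rfl⟩, ?_⟩
        rw [map_sub, ← hφx, hd, sub_self]
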